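/- arXiv:1501.02357 — 3 statements merged into one kernel-verified Lean document; each statement's English description precedes it below -/
import Mathlib

section
/- A nonempty closed subset S of Euclidean space ℝⁿ is convex if and only if to each point of ℝⁿ there corresponds a unique nearest point in S; that is, S is convex if and only if for every x ∈ ℝⁿ there exists a unique y ∈ S with dist x y = infDist x S. -/
open Metric

section NearestPoint

variable {E : Type*} [NormedAddCommGroup E] [InnerProductSpace ℝ E]

/-- A point has at most one nearest point in a convex set. -/
theorem Convex.eq_of_dist_eq_infDist {S : Set E} (hS : Convex ℝ S) {x y z : E}
    (hy : y ∈ S) (hz : z ∈ S) (hxy : dist x y = infDist x S) (hxz : dist x z = infDist x S) :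
    y = z := by
  have hm : (1 / 2 : ℝ) • y + (1 / 2 : ℝ) • z ∈ S :=
    hS hy hz (by norm_num) (by norm_num) (by norm_num)
  have hle := infDist_le_dist_of_mem (x := x) hm
  have hpar := parallelogram_law_with_norm ℝ (x - y) (x - z)
  have hsum : x - y + (x - z) = (2 : ℝ) • (x - ((1 / 2 : ℝ) • y + (1 / 2 : ℝ) • z)) := by
    module
  have hdiff : x - y - (x - z) = z - y := by abel
  rw [hsum, hdiff, norm_smul, ← dist_eq_norm, ← dist_eq_norm x y, ← dist_eq_norm x z,
    hxy, hxz, Real.norm_ofNat] at hpar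
  have hnonneg := infDist_nonneg (x := x) (s := S)
  have hzero : ‖z - y‖ = 0 := by
    nlinarith [norm_nonneg (z - y)]
  exact (sub_eq_zero.mp (norm_eq_zero.mp hzero)).symm

variable [ProperSpace E]

/-- If a point `z` off a closed set has a unique nearest point in the set, then the distance to
the set grows at any rate `c < 1` along some arbitrarily short displacement of `z`. -/
theorem exists_infDist_add_mul_lt {S : Set E} (hne : S.Nonempty) (hclosed : IsClosed S) {z : E}
    (huniq : ∃! y, y ∈ S ∧ dist z y = infDist z S) (hz : 0 < infDist z S) {c : ℝ}
    (hc₀ : 0 ≤ c) (hc : c < 1) {ε : ℝ} (hε : 0 < ε) :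
    ∃ w, dist w z < ε ∧ infDist z S + c * dist w z < infDist w S := by
  obtain ⟨p, ⟨hpS, hp⟩, hpu⟩ := huniq
  set d := infDist z S
  set u : E := d⁻¹ • (z - p)
  have hu : ‖u‖ = 1 := by
    rw [norm_smul, ← dist_eq_norm, hp, norm_inv, Real.norm_of_nonneg hz.le,
      inv_mul_cancel₀ hz.ne']
  have hup : inner ℝ u (z - p) = d := by
    rw [real_inner_smul_left, real_inner_self_eq_norm_sq, ← dist_eq_norm, hp]
    field_simp
  -- Nearest points of small displacements of `z` stay out of `A`.
  let A : Set E := S ∩ {q | inner ℝ u (z - q) ≤ c * d}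
  have hA : IsClosed A :=
    hclosed.inter (isClosed_le (by fun_prop) continuous_const)
  obtain ⟨m, hdm, hm⟩ : ∃ m, d < m ∧ ∀ q ∈ A, m ≤ dist z q := by
    rcases A.eq_empty_or_nonempty with h | h
    · exact ⟨d + 1, by linarith, by simp [h]⟩
    · obtain ⟨q, hq, hqd⟩ := hA.exists_infDist_eq_dist h z
      refine ⟨infDist z A, ?_, fun _ ↦ infDist_le_dist_of_mem⟩
      refine lt_of_le_of_ne (hqd ▸ infDist_le_dist_of_mem hq.1) fun heq ↦ ?_
      have hqp : q = p := hpu q ⟨hq.1, by rw [← hqd, ← heq]⟩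
      have hqA : inner ℝ u (z - q) ≤ c * d := hq.2
      rw [hqp, hup] at hqA
      nlinarith
  obtain ⟨t, ht, htmin⟩ := exists_between (lt_min hε (half_pos (sub_pos.mpr hdm)))
  have htε := htmin.trans_le (min_le_left _ _)
  have htm := htmin.trans_le (min_le_right _ _)
  have hdist : dist (z + t • u) z = t := by
    rw [dist_eq_norm, add_sub_cancel_left, norm_smul, hu, mul_one, Real.norm_of_nonneg ht.le]
  refine ⟨z + t • u, by rwa [hdist], ?_⟩
  obtain ⟨q, hq, hqd⟩ := hclosed.exists_infDist_eq_dist hne (z + t • u)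
  have hqA : c * d < inner ℝ u (z - q) := by
    by_contra! h
    have h₁ := hm q ⟨hq, h⟩
    have h₂ := infDist_le_infDist_add_dist (s := S) (x := z + t • u) (y := z)
    have h₃ := dist_triangle_left z q (z + t • u)
    rw [hdist] at h₂ h₃
    linarith
  have hdq : d ≤ ‖z - q‖ := dist_eq_norm z q ▸ infDist_le_dist_of_mem hq
  have hexp : ‖z + t • u - q‖ ^ 2 = ‖z - q‖ ^ 2 + 2 * (t * inner ℝ u (z - q)) + t ^ 2 := by
    rw [show z + t • u - q = z - q + t • u by abel, norm_add_sq_real, real_inner_smul_right,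
      real_inner_comm, norm_smul, hu, mul_one, Real.norm_of_nonneg ht.le]
  rw [hdist, hqd, dist_eq_norm]
  refine lt_of_pow_lt_pow_left₀ 2 (norm_nonneg _) ?_
  rw [hexp]
  have h₁ := mul_lt_mul_of_pos_left hqA ht
  have h₂ : d ^ 2 ≤ ‖z - q‖ ^ 2 := by gcongr
  have h₃ : (c * t) ^ 2 ≤ t ^ 2 := by gcongr; nlinarith
  nlinarith

/-- If nearest points in a closed set are unique, the distance to the set grows at unit rate
from any point off the set up to some point at any prescribed distance. -/
theorem exists_infDist_add_le_of_existsUnique {S : Set E} (hne : S.Nonempty)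
    (hclosed : IsClosed S) (huniq : ∀ x, ∃! y, y ∈ S ∧ dist x y = infDist x S) {x : E}
    (hx : 0 < infDist x S) {r : ℝ} (hr : 0 < r) :
    ∃ z, dist z x = r ∧ infDist x S + r ≤ infDist z S := by
  have hcomp := isCompact_closedBall x r
  have hball : (closedBall x r).Nonempty := ⟨x, mem_closedBall_self hr.le⟩
  have hcont := continuous_infDist_pt S
  obtain ⟨z, hz, hzmax⟩ := hcomp.exists_isMaxOn hball hcont.continuousOn
  have key : ∀ c : ℝ, 0 ≤ c → c < 1 → infDist x S + c * r ≤ infDist z S := by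
    intro c hc₀ hc
    obtain ⟨y, hy, hymax⟩ := hcomp.exists_isMaxOn hball
      (f := fun y ↦ infDist y S - c * dist y x) (by fun_prop)
    have hyx : infDist x S ≤ infDist y S - c * dist y x := by
      simpa using hymax (mem_closedBall_self hr.le)
    have hyr : dist y x = r := by
      refine (mem_closedBall.mp hy).antisymm (not_lt.mp fun hlt ↦ ?_)
      have hypos : 0 < infDist y S := by
        nlinarith [mul_nonneg hc₀ (dist_nonneg (x := y) (y := x))]
      obtain ⟨w, hw, hwd⟩ := exists_infDist_add_mul_lt hne hclosed (huniq y) hypos hc₀ hc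
        (sub_pos.mpr hlt)
      have htri := dist_triangle w y x
      have hwmax : infDist w S - c * dist w x ≤ infDist y S - c * dist y x :=
        hymax (mem_closedBall.mpr (by linarith))
      nlinarith [mul_le_mul_of_nonneg_left htri hc₀]
    have hyz : infDist y S ≤ infDist z S := hzmax hy
    rw [hyr] at hyx
    linarith
  have hle : infDist x S + r ≤ infDist z S := by
    refine le_of_forall_pos_sub_le fun ε hε ↦ ?_
    have hmax : 0 ≤ max 0 (1 - ε / r) := le_max_left _ _
    have h := key _ hmax (max_lt one_pos (sub_lt_self _ (div_pos hε hr)))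
    have h₂ := mul_le_mul_of_nonneg_right (le_max_right 0 (1 - ε / r)) hr.le
    rw [sub_mul, div_mul_cancel₀ _ hr.ne'] at h₂
    linarith
  refine ⟨z, (mem_closedBall.mp hz).antisymm ?_, hle⟩
  linarith [infDist_le_infDist_add_dist (s := S) (x := z) (y := x)]

/-- If nearest points in a closed set are unique, any point off the set is strictly separated
from it by the hyperplane through its nearest point `p` orthogonal to `x - p`. -/
theorem sq_infDist_le_inner_of_existsUnique {S : Set E} (hclosed : IsClosed S)
    (huniq : ∀ x, ∃! y, y ∈ S ∧ dist x y = infDist x S) {x p s : E}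
    (hx : 0 < infDist x S) (hpS : p ∈ S) (hp : dist x p = infDist x S) (hs : s ∈ S) :
    infDist x S ^ 2 ≤ inner ℝ (x - p) (x - s) := by
  set d := infDist x S
  rw [dist_eq_norm] at hp
  have key : ∀ r : ℝ, 0 < r →
      2 * r * (d ^ 2 - inner ℝ (x - p) (x - s)) ≤ d * (‖x - s‖ ^ 2 - d ^ 2) := by
    intro r hr
    obtain ⟨z, hzx, hz⟩ := exists_infDist_add_le_of_existsUnique ⟨p, hpS⟩ hclosed huniq hx hr
    rw [dist_eq_norm] at hzx
    have hexp : ∀ q ∈ S,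
        (d + r) ^ 2 ≤ r ^ 2 + 2 * inner ℝ (z - x) (x - q) + ‖x - q‖ ^ 2 := by
      intro q hq
      rw [← hzx, ← norm_add_sq_real, sub_add_sub_cancel, hzx, ← dist_eq_norm]
      have := hz.trans (infDist_le_dist_of_mem hq)
      gcongr
    have hinner := hexp p hpS
    rw [hp] at hinner
    have hsq : ‖d • (z - x) - r • (x - p)‖ ^ 2 ≤ 0 := by
      rw [norm_sub_sq_real, norm_smul, norm_smul, hzx, hp, real_inner_smul_left,
        real_inner_smul_right, Real.norm_of_nonneg hx.le, Real.norm_of_nonneg hr.le]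
      nlinarith [mul_pos hx hr]
    have heq : d • (z - x) = r • (x - p) := by
      rw [← sub_eq_zero, ← norm_eq_zero]
      exact pow_eq_zero_iff two_ne_zero |>.mp (hsq.antisymm (sq_nonneg _))
    have hs' := mul_le_mul_of_nonneg_left (hexp s hs) hx.le
    have hscale : d * inner ℝ (z - x) (x - s) = r * inner ℝ (x - p) (x - s) := by
      rw [← real_inner_smul_left, heq, real_inner_smul_left]
    nlinarith
  by_contra! hlt
  obtain ⟨n, hn⟩ := exists_nat_gt
    (d * (‖x - s‖ ^ 2 - d ^ 2) / (d ^ 2 - inner ℝ (x - p) (x - s)))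
  rw [div_lt_iff₀ (sub_pos.mpr hlt)] at hn
  have h := key (n + 1) (by positivity)
  have hn₀ : (0 : ℝ) ≤ n := n.cast_nonneg
  nlinarith [mul_nonneg hn₀ (sub_pos.mpr hlt).le]

/-- A closed set in which every point has a unique nearest point is convex. -/
theorem IsClosed.convex_of_existsUnique {S : Set E} (hclosed : IsClosed S)
    (huniq : ∀ x, ∃! y, y ∈ S ∧ dist x y = infDist x S) : Convex ℝ S := by
  intro a ha b hb α β hα hβ hαβ
  by_contra hx
  set x := α • a + β • b
  have hpos := (hclosed.notMem_iff_infDist_pos ⟨a, ha⟩).mp hx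
  obtain ⟨p, ⟨hpS, hp⟩, -⟩ := huniq x
  have hsa := sq_infDist_le_inner_of_existsUnique hclosed huniq hpos hpS hp ha
  have hsb := sq_infDist_le_inner_of_existsUnique hclosed huniq hpos hpS hp hb
  have hcomb : α • (x - a) + β • (x - b) = 0 := by
    have : α • (x - a) + β • (x - b) = (α + β) • x - (α • a + β • b) := by module
    rw [this, hαβ, one_smul, sub_self]
  have hzero : α * inner ℝ (x - p) (x - a) + β * inner ℝ (x - p) (x - b) = 0 := by
    rw [← real_inner_smul_right, ← real_inner_smul_right, ← inner_add_right, hcomb,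
      inner_zero_right]
  have h₁ := mul_le_mul_of_nonneg_left hsa hα
  have h₂ := mul_le_mul_of_nonneg_left hsb hβ
  have h₃ : α * infDist x S ^ 2 + β * infDist x S ^ 2 = infDist x S ^ 2 := by
    rw [← add_mul, hαβ, one_mul]
  have := pow_pos hpos 2
  linarith

end NearestPoint

/-- Motzkin's characterization: a nonempty closed subset of Euclidean space is
convex iff every point of the space has a unique nearest point in the set. -/
theorem convex_iff_existsUnique_nearest_point {n : ℕ}
    (S : Set (EuclideanSpace ℝ (Fin n))) (hS : S.Nonempty) (hclosed : IsClosed S) :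
    Convex ℝ S ↔
      ∀ x : EuclideanSpace ℝ (Fin n), ∃! y, y ∈ S ∧ dist x y = Metric.infDist x S := by
  refine ⟨fun hconv x ↦ ?_, hclosed.convex_of_existsUnique⟩
  obtain ⟨y, hy, hxy⟩ := hclosed.exists_infDist_eq_dist hS x
  exact ⟨y, ⟨hy, hxy.symm⟩, fun z hz ↦ hconv.eq_of_dist_eq_infDist hz.1 hy hz.2 hxy.symm⟩
end

section
/- Let S be a nonempty closed convex subset of Euclidean space ℝⁿ and let z ∈ S. Then the set S_z = {x ∈ ℝⁿ | dist x z = infDist x S} of points whose distance to S is attained at z is a convex cone with apex z: S_z is convex, and for every x ∈ S_z and every real t ≥ 0, the point z + t • (x − z) belongs to S_z. -/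
/-- A point `z` of a convex set `S` realizes the distance from `x` to `S` if and only if
`x - z` lies in the normal cone of `S` at `z`. -/
theorem dist_eq_infDist_iff_real_inner_le_zero {F : Type*} [NormedAddCommGroup F]
    [InnerProductSpace ℝ F] {S : Set F} (hconv : Convex ℝ S) {x z : F} (hz : z ∈ S) :
    dist x z = Metric.infDist x S ↔ ∀ w ∈ S, inner ℝ (x - z) (w - z) ≤ 0 := by
  simpa only [Metric.infDist_eq_iInf, dist_eq_norm] using
    norm_eq_iInf_iff_real_inner_le_zero hconv (u := x) hz

/-- Phelps: for a nonempty closed convex `S` and `z ∈ S`, the set of points whose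
distance to `S` is attained at `z` is a convex cone with apex `z`. -/
theorem nearest_point_set_is_convex_cone {n : ℕ}
    (S : Set (EuclideanSpace ℝ (Fin n))) (hS : S.Nonempty) (hclosed : IsClosed S)
    (hconv : Convex ℝ S) (z : EuclideanSpace ℝ (Fin n)) (hz : z ∈ S) :
    Convex ℝ {x : EuclideanSpace ℝ (Fin n) | dist x z = Metric.infDist x S} ∧
      ∀ x ∈ {x : EuclideanSpace ℝ (Fin n) | dist x z = Metric.infDist x S},
        ∀ t : ℝ, 0 ≤ t →
          z + t • (x - z) ∈ {x : EuclideanSpace ℝ (Fin n) | dist x z = Metric.infDist x S} := by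
  simp only [dist_eq_infDist_iff_real_inner_le_zero hconv hz, Set.mem_ofPred_eq]
  refine ⟨?_, ?_⟩
  · intro x hx y hy a b ha hb hab w hw
    have h : a • x + b • y - z = a • (x - z) + b • (y - z) := by
      rw [smul_sub, smul_sub, sub_add_sub_comm, ← add_smul, hab, one_smul]
    rw [h, inner_add_left, real_inner_smul_left, real_inner_smul_left]
    exact add_nonpos (mul_nonpos_of_nonneg_of_nonpos ha (hx w hw))
      (mul_nonpos_of_nonneg_of_nonpos hb (hy w hw))
  · intro x hx t ht w hw
    rw [add_sub_cancel_left, real_inner_smul_left]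
    exact mul_nonpos_of_nonneg_of_nonpos ht (hx w hw)
end

section
/- Let T₁ and T₂ be finite families of triangles in ℝ² satisfying the common-face condition, and let A = ⋃ T₁ and B = ⋃ T₂ be the unions of the two families. Then closure A ∩ closure B ≠ ∅ if and only if some triangle of T₁ and some triangle of T₂ have a common vertex. (In a Delaunay mesh, A δ B if and only if A v B: the visibility relation coincides with the Wallman proximity.) -/
theorem isClosed_biUnion_convexHull_range {ι E : Type*} [Finite ι] [AddCommGroup E] [Module ℝ E]
    [TopologicalSpace E] [T2Space E] [IsTopologicalAddGroup E] [ContinuousSMul ℝ E]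
    {T : Set (ι → E)} (hT : T.Finite) :
    IsClosed (⋃ t ∈ T, convexHull ℝ (Set.range t)) :=
  hT.isClosed_biUnion fun t _ => (Set.finite_range t).isClosed_convexHull ℝ

/-- In a Delaunay mesh, the Wallman proximity `A δ B` coincides with the
visibility relation `A v B`: for two finite families of triangles satisfying the
common-face condition, the closures of their unions meet iff some triangle of
the first family and some triangle of the second family share a vertex. -/
theorem delaunay_near_iff_visible
    (T₁ T₂ : Set (Fin 3 → EuclideanSpace ℝ (Fin 2)))
    (hT₁fin : T₁.Finite) (hT₂fin : T₂.Finite)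
    (hT₁ind : ∀ t ∈ T₁, AffineIndependent ℝ t)
    (hT₂ind : ∀ t ∈ T₂, AffineIndependent ℝ t)
    (hface : ∀ t₁ ∈ T₁, ∀ t₂ ∈ T₂,
      convexHull ℝ (Set.range t₁) ∩ convexHull ℝ (Set.range t₂) =
        convexHull ℝ (Set.range t₁ ∩ Set.range t₂))
    (A B : Set (EuclideanSpace ℝ (Fin 2)))
    (hA : A = ⋃ t ∈ T₁, convexHull ℝ (Set.range t))
    (hB : B = ⋃ t ∈ T₂, convexHull ℝ (Set.range t)) :
    closure A ∩ closure B ≠ ∅ ↔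
      ∃ t₁ ∈ T₁, ∃ t₂ ∈ T₂, ∃ v, v ∈ Set.range t₁ ∧ v ∈ Set.range t₂ := by
  subst hA hB
  rw [(isClosed_biUnion_convexHull_range hT₁fin).closure_eq,
    (isClosed_biUnion_convexHull_range hT₂fin).closure_eq, ← Set.nonempty_iff_ne_empty]
  constructor
  · rintro ⟨x, hx₁, hx₂⟩
    simp only [Set.mem_iUnion, exists_prop] at hx₁ hx₂
    obtain ⟨t₁, ht₁, hx₁⟩ := hx₁
    obtain ⟨t₂, ht₂, hx₂⟩ := hx₂
    have hx : x ∈ convexHull ℝ (Set.range t₁ ∩ Set.range t₂) :=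
      hface t₁ ht₁ t₂ ht₂ ▸ ⟨hx₁, hx₂⟩
    obtain ⟨v, hv⟩ := convexHull_nonempty_iff.mp ⟨x, hx⟩
    exact ⟨t₁, ht₁, t₂, ht₂, v, hv⟩
  · rintro ⟨t₁, ht₁, t₂, ht₂, v, hv₁, hv₂⟩
    exact ⟨v, Set.mem_biUnion ht₁ (subset_convexHull ℝ _ hv₁),
      Set.mem_biUnion ht₂ (subset_convexHull ℝ _ hv₂)⟩
end
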